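/- Upper bound of the variational principle: Let (X,G) be a G-action topological dynamical system with G a countable infinite discrete amenable group, and let {F_n} be a sequence of finite subsets of G satisfying the growth condition. If Z ⊆ X is an analytic set with h^P_top(Z,{F_n}) > 0, then for every 0 < s < h^P_top(Z,{F_n}) there exist a compact set K ⊆ Z and a Borel probability measure μ supported on K such that h̄^loc_μ(K,{F_n}) ≥ s. -/

import Mathlib

open Filter Set MeasureTheory ENNReal Topology
open scoped Pointwise symmDiff NNReal

namespace AmenablePacking

variable {G X Y : Type*}

/-- The open dynamical (Bowen) ball of center `x` and radius `ε` over the finite set `F`. -/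
def dynBall [PseudoMetricSpace X] (act : G → X → X) (F : Finset G) (x : X) (ε : ℝ) : Set X :=
  {y | ∀ g ∈ F, dist (act g x) (act g y) < ε}

/-- The closed dynamical (Bowen) ball of center `x` and radius `ε` over the finite set `F`. -/
def dynClosedBall [PseudoMetricSpace X] (act : G → X → X) (F : Finset G) (x : X) (ε : ℝ) :
    Set X :=
  {y | ∀ g ∈ F, dist (act g x) (act g y) ≤ ε}

/-- The packing pre-measure `P(Z, N, ε, s, {F_n})`: the supremum of `∑ᵢ exp (- s |F_{n_i}|)` over
all finite or countable pairwise disjoint families of closed Bowen balls with centers in `Z`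
and indices `n_i ≥ N`. -/
noncomputable def packP [PseudoMetricSpace X] (act : G → X → X) (Fs : ℕ → Finset G) (Z : Set X)
    (N : ℕ) (ε s : ℝ) : ℝ≥0∞ :=
  ⨆ (t : Set ℕ) (c : ℕ → X × ℕ) (_ : ∀ i ∈ t, (c i).1 ∈ Z ∧ N ≤ (c i).2)
    (_ : ∀ i ∈ t, ∀ j ∈ t, i ≠ j →
      Disjoint (dynClosedBall act (Fs (c i).2) (c i).1 ε)
        (dynClosedBall act (Fs (c j).2) (c j).1 ε)),
    ∑' i : t, ENNReal.ofReal (Real.exp (-s * ((Fs (c (i : ℕ)).2).card : ℝ)))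

/-- `P(Z, ε, s, {F_n}) = lim_{N → ∞} P(Z, N, ε, s, {F_n})`; the quantity is non-increasing
in `N`, so the limit equals the infimum. -/
noncomputable def packPLim [PseudoMetricSpace X] (act : G → X → X) (Fs : ℕ → Finset G)
    (Z : Set X) (ε s : ℝ) : ℝ≥0∞ :=
  ⨅ N : ℕ, packP act Fs Z N ε s

/-- `𝒫(Z, ε, s, {F_n})`: the countably subadditive envelope of `P(·, ε, s, {F_n})`. -/
noncomputable def packOuter [PseudoMetricSpace X] (act : G → X → X) (Fs : ℕ → Finset G)
    (Z : Set X) (ε s : ℝ) : ℝ≥0∞ :=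
  ⨅ (Zs : ℕ → Set X) (_ : Z ⊆ ⋃ i, Zs i), ∑' i, packPLim act Fs (Zs i) ε s

/-- `h^P_top(Z, ε, {F_n})`: the critical value of `s ≥ 0` at which `𝒫(Z, ε, s, {F_n})` jumps
from `+∞` to `0`. -/
noncomputable def packEntEps [PseudoMetricSpace X] (act : G → X → X) (Fs : ℕ → Finset G)
    (Z : Set X) (ε : ℝ) : ℝ≥0∞ :=
  ⨅ (s : ℝ≥0) (_ : packOuter act Fs Z ε (s : ℝ) = 0), (s : ℝ≥0∞)

/-- The amenable packing topological entropy
`h^P_top(Z, {F_n}) = lim_{ε → 0} h^P_top(Z, ε, {F_n})`. -/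
noncomputable def packEnt [PseudoMetricSpace X] (act : G → X → X) (Fs : ℕ → Finset G)
    (Z : Set X) : ℝ≥0∞ :=
  ⨆ (ε : ℝ) (_ : 0 < ε), packEntEps act Fs Z ε

/-- The Bowen pre-measure `ℳ(Z, N, ε, s, {F_n})`: the infimum of `∑ᵢ exp (- s |F_{n_i}|)` over
all finite or countable families of open Bowen balls with indices `n_i ≥ N` covering `Z`. -/
noncomputable def bowenM [PseudoMetricSpace X] (act : G → X → X) (Fs : ℕ → Finset G) (Z : Set X)
    (N : ℕ) (ε s : ℝ) : ℝ≥0∞ :=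
  ⨅ (t : Set ℕ) (c : ℕ → X × ℕ) (_ : ∀ i ∈ t, N ≤ (c i).2)
    (_ : Z ⊆ ⋃ i ∈ t, dynBall act (Fs (c i).2) (c i).1 ε),
    ∑' i : t, ENNReal.ofReal (Real.exp (-s * ((Fs (c (i : ℕ)).2).card : ℝ)))

/-- `ℳ(Z, s, {F_n}) = lim_{ε → 0} lim_{N → ∞} ℳ(Z, N, ε, s, {F_n})`. -/
noncomputable def bowenMLim [PseudoMetricSpace X] (act : G → X → X) (Fs : ℕ → Finset G)
    (Z : Set X) (s : ℝ) : ℝ≥0∞ :=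
  ⨆ (ε : ℝ) (_ : 0 < ε), ⨆ N : ℕ, bowenM act Fs Z N ε s

/-- The amenable Bowen topological entropy `h^B_top(Z, {F_n})`: the critical value of `s ≥ 0`
at which `ℳ(Z, s, {F_n})` jumps from `+∞` to `0`. -/
noncomputable def bowenEnt [PseudoMetricSpace X] (act : G → X → X) (Fs : ℕ → Finset G)
    (Z : Set X) : ℝ≥0∞ :=
  ⨅ (s : ℝ≥0) (_ : bowenMLim act Fs Z (s : ℝ) = 0), (s : ℝ≥0∞)

/-- `E` is an `(F, ε)`-separated set: distinct points are at `d_F`-distance `> ε`. -/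
def IsDynSeparated [PseudoMetricSpace X] (act : G → X → X) (F : Finset G) (ε : ℝ)
    (E : Set X) : Prop :=
  ∀ x ∈ E, ∀ y ∈ E, x ≠ y → ∃ g ∈ F, ε < dist (act g x) (act g y)

/-- `s_F(Z, ε)`: the maximal cardinality of an `(F, ε)`-separated subset of `Z`. -/
noncomputable def sepNum [PseudoMetricSpace X] (act : G → X → X) (F : Finset G) (Z : Set X)
    (ε : ℝ) : ℕ :=
  sSup {k : ℕ | ∃ E : Finset X, ↑E ⊆ Z ∧ IsDynSeparated act F ε ↑E ∧ E.card = k}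

/-- The upper capacity entropy of `Z` at scale `ε`:
`limsup_n (1/|F_n|) log s_{F_n}(Z, ε)`. -/
noncomputable def ucEntEps [PseudoMetricSpace X] (act : G → X → X) (Fs : ℕ → Finset G)
    (Z : Set X) (ε : ℝ) : ℝ≥0∞ :=
  limsup (fun n => ENNReal.ofReal (Real.log ((sepNum act (Fs n) Z ε : ℝ)) / ((Fs n).card : ℝ)))
    atTop

/-- The upper capacity topological entropy `h^{UC}_top(Z, {F_n})`. -/
noncomputable def ucEnt [PseudoMetricSpace X] (act : G → X → X) (Fs : ℕ → Finset G)
    (Z : Set X) : ℝ≥0∞ :=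
  ⨆ (ε : ℝ) (_ : 0 < ε), ucEntEps act Fs Z ε

/-- The upper local entropy `h̄^loc_μ(Z, {F_n}) =
`∫_Z lim_{ε→0} limsup_n -(1/|F_n|) log μ(B_{F_n}(x, ε)) dμ`. -/
noncomputable def upperLocalEnt [PseudoMetricSpace X] [MeasurableSpace X] (act : G → X → X)
    (Fs : ℕ → Finset G) (μ : Measure X) (Z : Set X) : ℝ≥0∞ :=
  ∫⁻ x in Z, ⨆ (ε : ℝ) (_ : 0 < ε),
    limsup (fun n =>
      ENNReal.ofReal (-Real.log ((μ (dynBall act (Fs n) x ε)).toReal) / ((Fs n).card : ℝ)))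
      atTop ∂μ

/-- A Følner sequence: a sequence of nonempty finite subsets of `G` which is asymptotically
invariant, i.e. `|g F_n ∆ F_n| / |F_n| → 0` for every `g ∈ G`. -/
def Folner [Group G] [DecidableEq G] (Fs : ℕ → Finset G) : Prop :=
  (∀ n, (Fs n).Nonempty) ∧
    ∀ g : G,
      Tendsto (fun n => ((((Fs n).image fun h => g * h) ∆ Fs n).card : ℝ) / ((Fs n).card : ℝ))
        atTop (nhds 0)

/-- A tempered sequence: `|⋃_{k < n} F_k⁻¹ F_n| ≤ C |F_n|` for a constant `C > 0`. -/
def Tempered [Group G] [DecidableEq G] (Fs : ℕ → Finset G) : Prop :=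
  ∃ C : ℝ, 0 < C ∧
    ∀ n : ℕ, ((((Finset.range n).biUnion fun k => (Fs k)⁻¹ * Fs n).card : ℝ))
      ≤ C * ((Fs n).card : ℝ)

/-- The growth condition `lim_n |F_n| / log n = +∞`. -/
def GrowthCond (Fs : ℕ → Finset G) [Group G] : Prop :=
  Tendsto (fun n => ((Fs n).card : ℝ) / Real.log (n : ℝ)) atTop atTop

/-- The static (Shannon) entropy of the finite measurable partition of `X` induced by a map
into a finite set. -/
noncomputable def partEnt [MeasurableSpace X] (μ : Measure X) {ι : Type*} [Fintype ι]
    (P : X → ι) : ℝ :=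
  ∑ i : ι, Real.negMulLog ((μ (P ⁻¹' {i})).toReal)

/-- The measure-theoretic (Kolmogorov–Sinai) entropy `h_μ(X, G)` of the action w.r.t. the
invariant measure `μ`, computed along the Følner sequence `{F_n}`: the supremum over finite
measurable partitions `P` of `lim_n (1/|F_n|) H_μ(⋁_{g ∈ F_n} (act g)⁻¹ P)`. -/
noncomputable def measEnt [MeasurableSpace X] [DecidableEq G] (act : G → X → X)
    (Fs : ℕ → Finset G) (μ : Measure X) : ℝ≥0∞ :=
  ⨆ (k : ℕ) (P : X → Fin k) (_ : Measurable P),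
    limsup (fun n => ENNReal.ofReal
      ((partEnt μ fun x (g : (Fs n : Finset G)) => P (act (g : G) x)) / ((Fs n).card : ℝ)))
      atTop

/-- The set of generic points of `μ` w.r.t. `{F_n}`. -/
def genericPoints [TopologicalSpace X] [MeasurableSpace X] (act : G → X → X)
    (Fs : ℕ → Finset G) (μ : Measure X) : Set X :=
  {x | ∀ f : C(X, ℝ),
    Tendsto (fun n => (∑ g ∈ Fs n, f (act g x)) / ((Fs n).card : ℝ)) atTop
      (nhds (∫ y, f y ∂μ))}

/-- `μ` is invariant under the action. -/
def InvariantMeasure [MeasurableSpace X] (act : G → X → X) (μ : Measure X) : Prop :=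
  ∀ (g : G) (s : Set X), MeasurableSet s → μ (act g ⁻¹' s) = μ s

/-- The action is ergodic w.r.t. `μ`: every invariant measurable set is null or conull. -/
def ErgodicAction [MeasurableSpace X] (act : G → X → X) (μ : Measure X) : Prop :=
  ∀ s : Set X, MeasurableSet s → (∀ g : G, act g ⁻¹' s = s) → μ s = 0 ∨ μ s = 1


section RandomPaths

variable {S : Type*}

/-- The law of the (time-inhomogeneous) Markov chain started at `r` with transition
probabilities `P k`. -/
theorem exists_markov_chain_measure [MeasurableSpace S] [DiscreteMeasurableSpace S]
    (r : S) (P : ℕ → S → PMF S) :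
    ∃ ν : Measure (ℕ → S), IsProbabilityMeasure ν ∧ (∀ᵐ ω ∂ν, ω 0 = r) ∧
      ∀ (k : ℕ) (A : Set (S × S)), MeasurableSet A → ∀ η : ℝ≥0∞,
        (∀ a, (P k a).toMeasure {b | (a, b) ∈ A} ≤ η) →
          ν {ω | (ω k, ω (k + 1)) ∈ A} ≤ η := by
  let Q : ℕ → ProbabilityTheory.Kernel S S := fun k =>
    ⟨fun a => (P k a).toMeasure, Measurable.of_discrete⟩
  have hQ : ∀ k, ProbabilityTheory.IsMarkovKernel (Q k) := fun k =>
    ⟨fun a => inferInstanceAs (IsProbabilityMeasure (P k a).toMeasure)⟩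
  let κ : (n : ℕ) → ProbabilityTheory.Kernel ((i : Finset.Iic n) → (fun _ : ℕ => S) i)
      ((fun _ : ℕ => S) (n + 1)) := fun n =>
    (Q n).comap (fun x => x ⟨n, Finset.mem_Iic.2 le_rfl⟩) (measurable_pi_apply _)
  have hκ : ∀ n, ProbabilityTheory.IsMarkovKernel (κ n) := fun n => by
    dsimp only [κ]; infer_instance
  let ν : Measure (ℕ → S) :=
    ProbabilityTheory.Kernel.traj (X := fun _ : ℕ => S) κ 0 (fun _ => r)
  have hν : IsProbabilityMeasure ν := by dsimp only [ν]; infer_instance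
  refine ⟨ν, hν, ?_, ?_⟩
  · have h0 := ProbabilityTheory.Kernel.traj_map_frestrictLe_apply (X := fun _ : ℕ => S)
      (κ := κ) 0 0 (fun _ => r)
    rw [ProbabilityTheory.Kernel.partialTraj_self, ProbabilityTheory.Kernel.id_apply] at h0
    have hm : Measurable (Preorder.frestrictLe (π := fun _ : ℕ => S) 0) := by fun_prop
    refine ae_of_ae_map (f := Preorder.frestrictLe (π := fun _ : ℕ => S) 0) hm.aemeasurable
      (p := fun x => x ⟨0, Finset.mem_Iic.2 le_rfl⟩ = r) ?_
    dsimp only [ν]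
    rw [h0]
    refine (ae_dirac_iff ?_).2 rfl
    exact (MeasurableSet.of_discrete (s := {r})).preimage
      (measurable_pi_apply (⟨0, Finset.mem_Iic.2 le_rfl⟩ : Finset.Iic 0))
  · intro k A hA η h
    have key := ProbabilityTheory.Kernel.partialTraj_compProd_eq_map_traj
      (X := fun _ : ℕ => S) (κ := κ) (Nat.zero_le k) (x₀ := fun _ => r)
    let f : (((i : Finset.Iic k) → (fun _ : ℕ => S) i) × S) → S × S :=
      fun p => (p.1 ⟨k, Finset.mem_Iic.2 le_rfl⟩, p.2)
    have hf : Measurable f := by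
      dsimp only [f]; fun_prop
    have hset : {ω : ℕ → S | (ω k, ω (k + 1)) ∈ A} =
        (fun x : ℕ → S => (Preorder.frestrictLe (π := fun _ : ℕ => S) k x, x (k + 1))) ⁻¹'
          (f ⁻¹' A) := rfl
    have hm : Measurable
        (fun x : ℕ → S => (Preorder.frestrictLe (π := fun _ : ℕ => S) k x, x (k + 1))) := by
      fun_prop
    rw [hset, ← Measure.map_apply hm (hf hA), ← key, Measure.compProd_apply (hf hA)]
    have hle : ∀ x, κ k x (Prod.mk x ⁻¹' (f ⁻¹' A)) ≤ η :=
      fun x => h (x ⟨k, Finset.mem_Iic.2 le_rfl⟩)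
    refine (lintegral_mono hle).trans ?_
    rw [lintegral_const, measure_univ, mul_one]

/-- The set of states that a Markov chain started at `r` can reach at time `k`. -/
def reachable (r : S) (P : ℕ → S → PMF S) : ℕ → Set S
  | 0 => {r}
  | k + 1 => ⋃ a ∈ reachable r P k, (P k a).support

theorem finite_reachable (r : S) (P : ℕ → S → PMF S) (hP : ∀ k a, (P k a).support.Finite)
    (k : ℕ) : (reachable r P k).Finite := by
  induction k with
  | zero => exact Set.finite_singleton r
  | succ k ih => exact ih.biUnion fun a _ => hP k a

theorem ae_mem_support_of_markov_chain [MeasurableSpace S] [DiscreteMeasurableSpace S]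
    {r : S} {P : ℕ → S → PMF S}
    (hP : ∀ k a, (P k a).support.Finite) {ν : Measure (ℕ → S)} (h0 : ∀ᵐ ω ∂ν, ω 0 = r)
    (hν : ∀ (k : ℕ) (A : Set (S × S)), MeasurableSet A → ∀ η : ℝ≥0∞,
      (∀ a, (P k a).toMeasure {b | (a, b) ∈ A} ≤ η) → ν {ω | (ω k, ω (k + 1)) ∈ A} ≤ η) :
    ∀ᵐ ω ∂ν, ∀ k, ω k ∈ reachable r P k ∧ ω (k + 1) ∈ (P k (ω k)).support := by
  have hstep : ∀ k, ∀ᵐ ω ∂ν, ω k ∈ reachable r P k → ω (k + 1) ∈ (P k (ω k)).support := by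
    intro k
    let A : Set (S × S) := ⋃ a ∈ reachable r P k, {a} ×ˢ (P k a).supportᶜ
    have hA : MeasurableSet A := (finite_reachable r P hP k).measurableSet_biUnion fun a _ =>
      (MeasurableSet.of_discrete).prod MeasurableSet.of_discrete
    have hmem : ∀ a b, (a, b) ∈ A ↔ a ∈ reachable r P k ∧ b ∉ (P k a).support := by
      intro a b
      simp only [A, Set.mem_iUnion, Set.mem_prod, Set.mem_singleton_iff, Set.mem_compl_iff]
      constructor
      · rintro ⟨a', h, rfl, hb⟩
        exact ⟨h, hb⟩
      · rintro ⟨h, hb⟩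
        exact ⟨a, h, rfl, hb⟩
    have := hν k A hA 0 fun a => by
      rw [nonpos_iff_eq_zero, PMF.toMeasure_apply_eq_zero_iff _ MeasurableSet.of_discrete]
      rw [Set.disjoint_left]
      intro b hb hb'
      exact ((hmem a b).1 hb').2 hb
    rw [nonpos_iff_eq_zero] at this
    filter_upwards [compl_mem_ae_iff.2 this] with ω hω hk
    by_contra hb
    exact hω ((hmem _ _).2 ⟨hk, hb⟩)
  filter_upwards [h0, ae_all_iff.2 hstep] with ω h0 hω
  have hr : ∀ k, ω k ∈ reachable r P k := by
    intro k
    induction k with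
    | zero => exact h0
    | succ k ih => exact Set.mem_biUnion ih (hω k ih)
  exact fun k => ⟨hr k, hω k (hr k)⟩

end RandomPaths

section PackingOuter

variable [PseudoMetricSpace X]

theorem packPLim_empty (act : G → X → X) (Fs : ℕ → Finset G) (ε s : ℝ) :
    packPLim act Fs ∅ ε s = 0 := by
  rw [← nonpos_iff_eq_zero]
  refine (iInf_le _ 0).trans ?_
  refine iSup_le fun t => iSup_le fun c => iSup_le fun h => iSup_le fun _ => ?_
  have : IsEmpty t := ⟨fun i => (h i i.2).1⟩
  simp

/-- The packing quantity `𝒫(·, ε, s, {F_n})`, as an outer measure. -/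
noncomputable def packOuterMeasure (act : G → X → X) (Fs : ℕ → Finset G) (ε s : ℝ) :
    OuterMeasure X :=
  OuterMeasure.ofFunction (fun Z => packPLim act Fs Z ε s) (packPLim_empty act Fs ε s)

theorem packOuterMeasure_apply (act : G → X → X) (Fs : ℕ → Finset G) (ε s : ℝ) (Z : Set X) :
    packOuterMeasure act Fs ε s Z = packOuter act Fs Z ε s := rfl

theorem packOuter_le_packPLim (act : G → X → X) (Fs : ℕ → Finset G) (ε s : ℝ) (Z : Set X) :
    packOuter act Fs Z ε s ≤ packPLim act Fs Z ε s :=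
  OuterMeasure.ofFunction_le (m := fun Z => packPLim act Fs Z ε s)
    (m_empty := packPLim_empty act Fs ε s) Z

theorem mem_dynClosedBall_self (act : G → X → X) (F : Finset G) (x : X) {ε : ℝ} (hε : 0 ≤ ε) :
    x ∈ dynClosedBall act F x ε := fun g _ => by simpa using hε

/-- A set of positive packing premeasure contains the centers of a finite disjoint family of
closed Bowen balls of arbitrarily high order whose total weight is bounded below independently
of the order. -/
theorem exists_finset_disjoint_dynClosedBall {act : G → X → X} {Fs : ℕ → Finset G} {ε s : ℝ}
    (hε : 0 ≤ ε) {Z : Set X} {c : ℝ≥0∞} (hc : c < packPLim act Fs Z ε s) (N : ℕ) :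
    ∃ E : Finset (X × ℕ), (∀ b ∈ E, b.1 ∈ Z ∧ N ≤ b.2) ∧
      ((E : Set (X × ℕ)).PairwiseDisjoint fun b => dynClosedBall act (Fs b.2) b.1 ε) ∧
      c < ∑ b ∈ E, ENNReal.ofReal (Real.exp (-s * ((Fs b.2).card : ℝ))) := by
  have h : c < packP act Fs Z N ε s := hc.trans_le (iInf_le _ N)
  simp only [packP, lt_iSup_iff] at h
  obtain ⟨t, b, hb, hd, hsum⟩ := h
  rw [ENNReal.tsum_eq_iSup_sum, lt_iSup_iff] at hsum
  obtain ⟨T, hT⟩ := hsum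
  classical
  have hinj : Set.InjOn (fun i : t => b i) T := by
    intro i _ j _ hij
    by_contra hne
    have := hd i i.2 j j.2 fun h => hne (Subtype.ext h)
    dsimp only at hij
    rw [hij, disjoint_self] at this
    exact (this.le (mem_dynClosedBall_self act _ _ hε) : _)
  refine ⟨T.image fun i : t => b i, ?_, ?_, ?_⟩
  · intro x hx
    obtain ⟨i, _, rfl⟩ := Finset.mem_image.1 hx
    exact hb i i.2
  · intro x hx y hy hxy
    obtain ⟨i, _, rfl⟩ := Finset.mem_image.1 (Finset.mem_coe.1 hx)
    obtain ⟨j, _, rfl⟩ := Finset.mem_image.1 (Finset.mem_coe.1 hy)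
    exact hd i i.2 j j.2 fun h => hxy (by rw [h])
  · rwa [Finset.sum_image hinj]

/-- If `Z` has positive packing measure of exponent `s'`, then for `s < s'` it carries finitely
supported probability vectors on disjoint closed Bowen balls of arbitrarily high order, whose
weights are arbitrarily small multiples of `exp (- s |F_n|)`. -/
theorem exists_pmf_disjoint_dynClosedBall {act : G → X → X} {Fs : ℕ → Finset G} {ε s s' : ℝ}
    (hε : 0 ≤ ε) (hFs : Tendsto (fun n => ((Fs n).card : ℝ)) atTop atTop) (hs : s < s')
    {Z : Set X} (hZ : packOuter act Fs Z ε s' ≠ 0) (N : ℕ) {η : ℝ≥0∞} (hη : η ≠ 0) :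
    ∃ p : PMF (X × ℕ), p.support.Finite ∧ (∀ b ∈ p.support, b.1 ∈ Z ∧ N ≤ b.2 ∧
        p b ≤ η * ENNReal.ofReal (Real.exp (-s * ((Fs b.2).card : ℝ)))) ∧
      p.support.PairwiseDisjoint fun b => dynClosedBall act (Fs b.2) b.1 ε := by
  have hpos : 0 < packPLim act Fs Z ε s' :=
    (pos_iff_ne_zero.2 hZ).trans_le (packOuter_le_packPLim ..)
  obtain ⟨c, hc0, hc⟩ := exists_between hpos
  have hctop : c ≠ ∞ := hc.ne_top
  have hlim : Tendsto (fun n => ENNReal.ofReal (Real.exp (-(s' - s) * ((Fs n).card : ℝ))))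
      atTop (𝓝 0) := by
    have h := (Real.tendsto_exp_atBot.comp (hFs.const_mul_atTop_of_neg
      (r := -(s' - s)) (by linarith)))
    exact ENNReal.ofReal_zero ▸ (ENNReal.continuous_ofReal.tendsto 0).comp h
  obtain ⟨M, hM⟩ := eventually_atTop.1
    (hlim.eventually_lt_const (ENNReal.mul_pos hη hc0.ne'))
  obtain ⟨E, hE, hdisj, hsum⟩ := exists_finset_disjoint_dynClosedBall hε hc (max N M)
  let w : X × ℕ → ℝ≥0∞ :=
    (E : Set (X × ℕ)).indicator fun b => ENNReal.ofReal (Real.exp (-s' * ((Fs b.2).card : ℝ)))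
  have hw : ∑' b, w b = ∑ b ∈ E, ENNReal.ofReal (Real.exp (-s' * ((Fs b.2).card : ℝ))) :=
    (sum_eq_tsum_indicator _ _).symm
  have hw0 : ∑' b, w b ≠ 0 := by rw [hw]; exact (hc0.trans hsum).ne'
  have hwtop : ∑' b, w b ≠ ∞ := by
    rw [hw]; exact (ENNReal.sum_lt_top.2 fun _ _ => ENNReal.ofReal_lt_top).ne
  have hsupp : (PMF.normalize w hw0 hwtop).support ⊆ E := by
    rw [PMF.support_normalize]; exact Set.support_indicator_subset
  refine ⟨PMF.normalize w hw0 hwtop, E.finite_toSet.subset hsupp, fun b hb => ?_,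
    hdisj.subset hsupp⟩
  have hbE := hsupp hb
  obtain ⟨hbZ, hbN⟩ := hE b hbE
  refine ⟨hbZ, (le_max_left _ _).trans hbN, ?_⟩
  rw [PMF.normalize_apply, ← div_eq_mul_inv]
  have hexp : w b = ENNReal.ofReal (Real.exp (-(s' - s) * ((Fs b.2).card : ℝ))) *
      ENNReal.ofReal (Real.exp (-s * ((Fs b.2).card : ℝ))) := by
    rw [← ENNReal.ofReal_mul (Real.exp_nonneg _), ← Real.exp_add]
    simp only [w, Set.indicator_of_mem hbE]
    congr 2; ring
  refine ENNReal.div_le_of_le_mul ?_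
  calc w b ≤ (η * c) * ENNReal.ofReal (Real.exp (-s * ((Fs b.2).card : ℝ))) := by
        rw [hexp]
        gcongr
        exact (hM _ ((le_max_right _ _).trans hbN)).le
    _ = η * ENNReal.ofReal (Real.exp (-s * ((Fs b.2).card : ℝ))) * c := by ring
    _ ≤ _ := by
        gcongr
        exact hw ▸ hsum.le

end PackingOuter

section BowenBalls

variable [PseudoMetricSpace X] {act : G → X → X}

theorem isOpen_dynBall (hact : ∀ g, Continuous (act g)) (F : Finset G) (x : X) (ε : ℝ) :
    IsOpen (dynBall act F x ε) := by
  have : dynBall act F x ε = ⋂ g ∈ F, {y | dist (act g x) (act g y) < ε} := by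
    ext y; simp [dynBall]
  rw [this]
  exact isOpen_biInter_finset fun g _ =>
    isOpen_lt (continuous_const.dist (hact g)) continuous_const

theorem isClosed_dynClosedBall (hact : ∀ g, Continuous (act g)) (F : Finset G) (x : X) (ε : ℝ) :
    IsClosed (dynClosedBall act F x ε) := by
  have : dynClosedBall act F x ε = ⋂ g ∈ F, {y | dist (act g x) (act g y) ≤ ε} := by
    ext y; simp [dynClosedBall]
  rw [this]
  exact isClosed_biInter fun g _ =>
    isClosed_le (continuous_const.dist (hact g)) continuous_const

theorem mem_dynBall_self (act : G → X → X) (F : Finset G) (x : X) {ε : ℝ} (hε : 0 < ε) :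
    x ∈ dynBall act F x ε := fun g _ => by simpa using hε

theorem dynBall_subset_dynClosedBall_of_mem {F : Finset G} {x y : X} {ε : ℝ}
    (hy : y ∈ dynBall act F x (ε / 2)) : dynBall act F y (ε / 2) ⊆ dynClosedBall act F x ε := by
  intro z hz g hg
  have h1 := hy g hg
  have h2 := hz g hg
  have := dist_triangle (act g x) (act g y) (act g z)
  linarith

end BowenBalls

section Nodes

/-- A node of the tree of cylinders along which the measure is spread: a point of `W`, the order
of the Bowen ball attached to it, and the length of the cylinder attached to it. -/
structure PathNode (W : Set (ℕ → ℕ)) where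
  /-- the point determining the cylinder -/
  pt : ℕ → ℕ
  /-- the point lies in `W` -/
  pt_mem : pt ∈ W
  /-- the order of the Bowen ball -/
  ord : ℕ
  /-- the length of the cylinder -/
  len : ℕ

variable {W : Set (ℕ → ℕ)}

instance : MeasurableSpace (PathNode W) := ⊤

instance : DiscreteMeasurableSpace (PathNode W) := ⟨fun _ => trivial⟩

instance : TopologicalSpace (PathNode W) := ⊥

instance : DiscreteTopology (PathNode W) := ⟨rfl⟩

/-- The point of the Baire space determined by a sequence of nodes with nested cylinders. -/
def pathLimit (ω : ℕ → PathNode W) : ℕ → ℕ := fun q => (ω (q + 1)).pt q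

theorem continuous_pathLimit : Continuous (pathLimit (W := W)) :=
  continuous_pi fun q => (continuous_of_discreteTopology (f := fun a : PathNode W => a.pt q)).comp
    (continuous_apply (q + 1))

theorem measurable_pathLimit : Measurable (pathLimit (W := W)) :=
  measurable_pi_iff.2 fun q => (Measurable.of_discrete (f := fun a : PathNode W => a.pt q)).comp
    (measurable_pi_apply (q + 1))

theorem pathLimit_mem_cylinder {ω : ℕ → PathNode W}
    (hcyl : ∀ k, (ω (k + 1)).pt ∈ PiNat.cylinder (ω k).pt (ω k).len)
    (hmono : ∀ k, (ω k).len ≤ (ω (k + 1)).len) (hlen : ∀ k, k + 1 ≤ (ω (k + 1)).len) (k : ℕ) :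
    pathLimit ω ∈ PiNat.cylinder (ω k).pt (ω k).len := by
  have hm : Monotone fun k => (ω k).len := monotone_nat_of_le_succ hmono
  have hagree : ∀ i j, i ≤ j → ∀ q < (ω i).len, (ω j).pt q = (ω i).pt q := by
    intro i j hij
    induction j, hij using Nat.le_induction with
    | base => exact fun _ _ => rfl
    | succ j hij ih =>
      intro q hq
      rw [← ih q hq]
      exact hcyl j q (hq.trans_le (hm hij))
  intro q hq
  rcases le_total k (q + 1) with h | h
  · exact hagree _ _ h q hq
  · exact (hagree _ _ h q (hlen q)).symm

/-- The node `b` refines the node `a` at stage `k`: its cylinder is contained in that of `a`, it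
has large length and order, and `φ` maps it into a small Bowen ball. -/
structure Refines [PseudoMetricSpace X] (act : G → X → X) (Fs : ℕ → Finset G)
    (φ : (ℕ → ℕ) → X) (ε : ℝ) (k : ℕ) (a b : PathNode W) : Prop where
  mem_cylinder : b.pt ∈ PiNat.cylinder a.pt a.len
  len_le : a.len ≤ b.len
  lt_len : k + 1 ≤ b.len
  le_ord : k ≤ b.ord
  mem_dynBall : ∀ z ∈ PiNat.cylinder b.pt b.len,
    φ z ∈ dynBall act (Fs b.ord) (φ b.pt) (ε / 2)

theorem exists_cylinder_subset {U : Set (ℕ → ℕ)} (hU : IsOpen U) {z : ℕ → ℕ} (hz : z ∈ U) :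
    ∃ m, ∀ n, m ≤ n → PiNat.cylinder z n ⊆ U := by
  obtain ⟨v, ⟨x, m, rfl⟩, hzv, hv⟩ :=
    (PiNat.isTopologicalBasis_cylinders (fun _ : ℕ => ℕ)).exists_subset_of_mem_open hz hU
  rw [← PiNat.mem_cylinder_iff_eq.1 hzv] at hv
  exact ⟨m, fun n hn => (PiNat.cylinder_anti z hn).trans hv⟩

theorem exists_node_splitting [PseudoMetricSpace X] {act : G → X → X} {Fs : ℕ → Finset G}
    (hact : ∀ g, Continuous (act g)) {φ : (ℕ → ℕ) → X} (hφ : Continuous φ) {ε s s' : ℝ}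
    (hε : 0 < ε) (hFs : Tendsto (fun n => ((Fs n).card : ℝ)) atTop atTop) (hs : s < s')
    (hW : ∀ a ∈ W, ∀ p, packOuter act Fs (φ '' (PiNat.cylinder a p ∩ W)) ε s' ≠ 0)
    (k : ℕ) (a : PathNode W) :
    ∃ P : PMF (PathNode W), P.support.Finite ∧
      (∀ b ∈ P.support, Refines act Fs φ ε k a b ∧
        P b ≤ 2⁻¹ ^ k * ENNReal.ofReal (Real.exp (-s * ((Fs b.ord).card : ℝ)))) ∧
      P.support.PairwiseDisjoint fun b => dynClosedBall act (Fs b.ord) (φ b.pt) ε := by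
  obtain ⟨p, hfin, hp, hdisj⟩ := exists_pmf_disjoint_dynClosedBall (act := act) hε.le hFs hs
    (hW a.pt a.pt_mem a.len) k (η := 2⁻¹ ^ k) (by simp)
  have hex : ∀ b : X × ℕ, ∃ n : PathNode W, b ∈ p.support →
      φ n.pt = b.1 ∧ n.ord = b.2 ∧ Refines act Fs φ ε k a n := by
    intro b
    by_cases hb : b ∈ p.support
    · obtain ⟨⟨z, ⟨hza, hzW⟩, hzb⟩, hbk, -⟩ := hp b hb
      obtain ⟨m, hm⟩ := exists_cylinder_subset
        ((isOpen_dynBall hact (Fs b.2) (φ z) (ε / 2)).preimage hφ)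
        (mem_dynBall_self act (Fs b.2) (φ z) (half_pos hε))
      exact ⟨⟨z, hzW, b.2, max m (max a.len (k + 1))⟩, fun _ => ⟨hzb, rfl, hza,
        (le_max_left _ _).trans (le_max_right _ _), (le_max_right _ _).trans (le_max_right _ _),
        hbk, fun y hy => hm _ (le_max_left _ _) hy⟩⟩
    · exact ⟨a, fun h => (hb h).elim⟩
  choose g hg using hex
  have hinj : Set.InjOn g p.support := by
    intro b hb c hc hbc
    obtain ⟨h1, h2, -⟩ := hg b hb
    obtain ⟨h3, h4, -⟩ := hg c hc
    refine Prod.ext ?_ ?_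
    · rw [← h1, ← h3, hbc]
    · rw [← h2, ← h4, hbc]
  refine ⟨p.map g, ?_, ?_, ?_⟩
  · rw [PMF.support_map]
    exact hfin.image g
  · intro n hn
    rw [PMF.support_map] at hn
    obtain ⟨b, hb, rfl⟩ := hn
    obtain ⟨-, h2, h3⟩ := hg b hb
    refine ⟨h3, ?_⟩
    have : p.map g (g b) = p b := by
      rw [PMF.map_apply, tsum_eq_single b, if_pos rfl]
      intro c hcb
      split_ifs with h
      · by_contra hc
        exact hcb (hinj ((PMF.mem_support_iff _ _).2 hc) hb h.symm)
      · rfl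
    rw [this, h2]
    exact (hp b hb).2.2
  · rw [PMF.support_map]
    rintro _ ⟨b, hb, rfl⟩ _ ⟨c, hc, rfl⟩ hbc
    obtain ⟨h1, h2, -⟩ := hg b hb
    obtain ⟨h3, h4, -⟩ := hg c hc
    dsimp only [Function.onFun]
    rw [h1, h2, h3, h4]
    exact hdisj hb hc fun h => hbc (congrArg g h)

end Nodes

/-- A Markov inequality: if a probability vector is dominated by `η * w` on indices of pairwise
disjoint sets, then the set of indices whose set has mass more than `w` has small probability. -/
theorem pmf_toMeasure_setOf_lt_le {ι : Type*} [MeasurableSpace ι] [DiscreteMeasurableSpace ι]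
    [MeasurableSpace X] (μ : Measure X) [IsProbabilityMeasure μ] (P : PMF ι)
    (hfin : P.support.Finite) {B : ι → Set X} (hB : ∀ i, MeasurableSet (B i))
    (hdisj : P.support.PairwiseDisjoint B) {w : ι → ℝ≥0∞} {η : ℝ≥0∞}
    (hP : ∀ i ∈ P.support, P i ≤ η * w i) : P.toMeasure {i | w i < μ (B i)} ≤ η := by
  rw [← PMF.toMeasure_apply_inter_support _ MeasurableSet.of_discrete]
  classical
  have heq : {i | w i < μ (B i)} ∩ P.support =
      ((hfin.toFinset.filter fun i => w i < μ (B i) : Finset ι) : Set ι) := by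
    ext i; simp [and_comm]
  rw [heq, PMF.toMeasure_apply_finset]
  calc ∑ i ∈ hfin.toFinset.filter (fun i => w i < μ (B i)), P i
      ≤ ∑ i ∈ hfin.toFinset.filter (fun i => w i < μ (B i)), η * μ (B i) := by
        refine Finset.sum_le_sum fun i hi => ?_
        rw [Finset.mem_filter, Set.Finite.mem_toFinset] at hi
        exact (hP i hi.1).trans (by gcongr; exact hi.2.le)
    _ ≤ η * ∑ i ∈ hfin.toFinset, μ (B i) := by
        rw [Finset.mul_sum]
        exact Finset.sum_le_sum_of_subset (Finset.filter_subset _ _)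
    _ = η * μ (⋃ i ∈ hfin.toFinset, B i) := by
        rw [measure_biUnion_finset (by simpa using hdisj) fun i _ => hB i]
    _ ≤ η * 1 := by gcongr; exact prob_le_one
    _ = η := mul_one η

/-- A set of positive packing measure that is a continuous image of the Baire space is, up to a
null part, the image of a set all of whose cylinders have image of positive packing measure. -/
theorem exists_everywhere_positive_subset [PseudoMetricSpace X] (act : G → X → X)
    (Fs : ℕ → Finset G) (φ : (ℕ → ℕ) → X) (ε s : ℝ)
    (hpos : packOuter act Fs (range φ) ε s ≠ 0) :
    ∃ W : Set (ℕ → ℕ), W.Nonempty ∧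
      ∀ a ∈ W, ∀ p, packOuter act Fs (φ '' (PiNat.cylinder a p ∩ W)) ε s ≠ 0 := by
  let ρ : OuterMeasure (ℕ → ℕ) := OuterMeasure.comap φ (packOuterMeasure act Fs ε s)
  have hρ : ∀ A, ρ A = packOuter act Fs (φ '' A) ε s := fun A => rfl
  let W : Set (ℕ → ℕ) := {a | ∀ p, ρ (PiNat.cylinder a p) ≠ 0}
  have hW : ρ Wᶜ = 0 := by
    refine measure_null_of_locally_null _ fun x hx => ?_
    simp only [W, Set.mem_compl_iff, Set.mem_ofPred_eq, not_forall, not_not] at hx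
    obtain ⟨p, hp⟩ := hx
    exact ⟨_, mem_nhdsWithin_of_mem_nhds ((PiNat.isOpen_cylinder _ x p).mem_nhds
      (PiNat.self_mem_cylinder x p)), hp⟩
  refine ⟨W, ?_, fun a ha p h => ha p ?_⟩
  · by_contra hne
    rw [Set.not_nonempty_iff_eq_empty] at hne
    rw [hne, Set.compl_empty, hρ, Set.image_univ] at hW
    exact hpos hW
  · rw [← nonpos_iff_eq_zero]
    calc ρ (PiNat.cylinder a p) ≤ ρ ((PiNat.cylinder a p ∩ W) ∪ Wᶜ) :=
          measure_mono fun x hx => by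
            by_cases hxW : x ∈ W
            · exact Or.inl ⟨hx, hxW⟩
            · exact Or.inr hxW
      _ ≤ ρ (PiNat.cylinder a p ∩ W) + ρ Wᶜ := measure_union_le _ _
      _ = 0 := by rw [hW, hρ, h, add_zero]

theorem tendsto_card_atTop_of_growthCond [Group G] {Fs : ℕ → Finset G} (h : GrowthCond Fs) :
    Tendsto (fun n => ((Fs n).card : ℝ)) atTop atTop := by
  refine tendsto_atTop_mono' atTop ?_ h
  filter_upwards [(Real.tendsto_log_atTop.comp tendsto_natCast_atTop_atTop).eventually_ge_atTop 1]
    with n hn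
  exact div_le_self (Nat.cast_nonneg _) hn

theorem exists_packOuter_ne_zero [PseudoMetricSpace X] {act : G → X → X} {Fs : ℕ → Finset G}
    {Z : Set X} {s : ℝ} (h : ENNReal.ofReal s < packEnt act Fs Z) :
    ∃ ε : ℝ, 0 < ε ∧ ∃ s' : ℝ, s < s' ∧ packOuter act Fs Z ε s' ≠ 0 := by
  simp only [packEnt, lt_iSup_iff] at h
  obtain ⟨ε, hε, h⟩ := h
  obtain ⟨s', h1, h2⟩ := ENNReal.lt_iff_exists_nnreal_btwn.1 h
  refine ⟨ε, hε, s', ?_, fun h0 => ?_⟩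
  · by_contra hle
    rw [not_lt] at hle
    refine h1.not_ge ?_
    rw [← ENNReal.ofReal_coe_nnreal]
    exact ENNReal.ofReal_le_ofReal hle
  · exact h2.not_ge (iInf₂_le s' h0)

/-- A measure whose Bowen balls are infinitely often exponentially small almost everywhere has
large upper local entropy. -/
theorem le_upperLocalEnt [PseudoMetricSpace X] [HereditarilyLindelofSpace X] [MeasurableSpace X]
    {act : G → X → X}
    (hact : ∀ g, Continuous (act g)) {Fs : ℕ → Finset G} (hne : ∀ n, (Fs n).Nonempty)
    {μ : Measure X} [IsProbabilityMeasure μ] {K : Set X} (hK : μ K = 1) {ε s : ℝ} (hε : 0 < ε)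
    (h : ∀ᵐ x ∂μ, ∃ᶠ n in atTop,
      μ (dynBall act (Fs n) x ε) ≤ ENNReal.ofReal (Real.exp (-s * ((Fs n).card : ℝ)))) :
    ENNReal.ofReal s ≤ upperLocalEnt act Fs μ K := by
  have hae : ∀ᵐ x ∂μ.restrict K, ENNReal.ofReal s ≤ ⨆ (ε : ℝ) (_ : 0 < ε),
      limsup (fun n => ENNReal.ofReal
        (-Real.log ((μ (dynBall act (Fs n) x ε)).toReal) / ((Fs n).card : ℝ))) atTop := by
    refine ae_restrict_of_ae ?_
    filter_upwards [h, Measure.support_mem_ae] with x hx hxs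
    refine le_iSup₂_of_le ε hε (le_limsup_of_frequently_le (hx.mono fun n hn => ?_))
    have hpos : 0 < μ (dynBall act (Fs n) x ε) :=
      (Measure.mem_support_iff_forall x).1 hxs _
        ((isOpen_dynBall hact _ _ _).mem_nhds (mem_dynBall_self act _ _ hε))
    have hcard : (0 : ℝ) < (Fs n).card := Nat.cast_pos.2 (hne n).card_pos
    refine ENNReal.ofReal_le_ofReal ((le_div_iff₀ hcard).2 ?_)
    have hreal : (μ (dynBall act (Fs n) x ε)).toReal ≤ Real.exp (-s * ((Fs n).card : ℝ)) :=
      ENNReal.toReal_le_of_le_ofReal (Real.exp_nonneg _) hn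
    have := Real.log_le_log (ENNReal.toReal_pos hpos.ne' (measure_ne_top _ _)) hreal
    rw [Real.log_exp] at this
    linarith
  calc ENNReal.ofReal s = ∫⁻ _ in K, ENNReal.ofReal s ∂μ := by
        rw [setLIntegral_const, hK, mul_one]
    _ ≤ _ := lintegral_mono_ae hae

theorem packing_entropy_variational_principle_upper_bound
    [Group G] [Countable G] [Infinite G] [DecidableEq G]
    [MetricSpace X] [CompactSpace X] [MeasurableSpace X] [BorelSpace X]
    (act : G → X → X)
    (hact_one : ∀ x, act 1 x = x)
    (hact_mul : ∀ g h x, act (g * h) x = act g (act h x))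
    (hact_cont : ∀ g : G, Continuous (act g))
    (hamen : ∃ E : ℕ → Finset G, Folner E)
    (Fs : ℕ → Finset G) (hne : ∀ n, (Fs n).Nonempty) (hgrow : GrowthCond Fs)
    (Z : Set X) (hZ : AnalyticSet Z) (hpos : 0 < packEnt act Fs Z) :
    ∀ s : ℝ, 0 < s → ENNReal.ofReal s < packEnt act Fs Z →
      ∃ K : Set X, K ⊆ Z ∧ IsCompact K ∧
        ∃ μ : Measure X, IsProbabilityMeasure μ ∧ μ K = 1 ∧
          ENNReal.ofReal s ≤ upperLocalEnt act Fs μ K := by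
  intro s _ hs
  obtain ⟨ε, hε, s', hss', hZpos⟩ := exists_packOuter_ne_zero hs
  rw [AnalyticSet] at hZ
  obtain rfl | ⟨φ, hφ, rfl⟩ := hZ
  · exact absurd (measure_empty (μ := packOuterMeasure act Fs ε s')) hZpos
  obtain ⟨W, ⟨z, hz⟩, hW⟩ := exists_everywhere_positive_subset act Fs φ ε s' hZpos
  choose P hfin hP hdisj using exists_node_splitting hact_cont hφ hε
    (tendsto_card_atTop_of_growthCond hgrow) hss' hW
  let r : PathNode W := ⟨z, hz, 0, 0⟩
  obtain ⟨ν, hν, h0, hstep⟩ := exists_markov_chain_measure r P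
  have hpath := ae_mem_support_of_markov_chain hfin h0 hstep
  have hf : Continuous fun ω : ℕ → PathNode W => φ (pathLimit ω) := hφ.comp continuous_pathLimit
  have hfm : Measurable fun ω : ℕ → PathNode W => φ (pathLimit ω) :=
    hφ.measurable.comp measurable_pathLimit
  let R : Set (ℕ → PathNode W) := Set.pi univ (reachable r P)
  have hR : IsCompact R := isCompact_univ_pi fun k => (finite_reachable r P hfin k).isCompact
  let K : Set X := (fun ω => φ (pathLimit ω)) '' R
  have hK : IsCompact K := hR.image hf
  let μ : Measure X := ν.map fun ω => φ (pathLimit ω)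
  have hμ : IsProbabilityMeasure μ := Measure.isProbabilityMeasure_map hfm.aemeasurable
  have hμK : μ K = 1 := by
    rw [← prob_compl_eq_zero_iff hK.measurableSet, Measure.map_apply hfm hK.measurableSet.compl,
      ← compl_mem_ae_iff, ← Set.preimage_compl, compl_compl]
    filter_upwards [hpath] with ω hω
    exact ⟨ω, fun k _ => (hω k).1, rfl⟩
  refine ⟨K, ?_, hK, μ, hμ, hμK, le_upperLocalEnt hact_cont hne hμK (half_pos hε) ?_⟩
  · rintro _ ⟨ω, _, rfl⟩
    exact Set.mem_range_self _
  let w : ℕ → ℝ≥0∞ := fun n => ENNReal.ofReal (Real.exp (-s * ((Fs n).card : ℝ)))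
  let bad : Set (PathNode W) := {b | w b.ord < μ (dynClosedBall act (Fs b.ord) (φ b.pt) ε)}
  have hbad : ∀ k, ν {ω | ω (k + 1) ∈ bad} ≤ 2⁻¹ ^ k := fun k =>
    hstep k (Prod.snd ⁻¹' bad) (measurable_snd MeasurableSet.of_discrete) _ fun a =>
      pmf_toMeasure_setOf_lt_le μ (P k a) (hfin k a)
        (fun b => (isClosed_dynClosedBall hact_cont _ _ _).measurableSet) (hdisj k a)
        fun b hb => (hP k a b hb).2
  have hbc : ∀ᵐ ω ∂ν, ∀ᶠ k in atTop, ω (k + 1) ∉ bad := by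
    refine ae_eventually_notMem (s := fun k => {ω : ℕ → PathNode W | ω (k + 1) ∈ bad}) ?_
    refine ((ENNReal.tsum_le_tsum hbad).trans_lt ?_).ne
    rw [ENNReal.tsum_geometric, ENNReal.one_sub_inv_two, inv_inv]
    exact ENNReal.ofNat_lt_top
  let U : ℕ → Set X := fun j => ⋃ (n : ℕ) (_ : j ≤ n) (y : X)
    (_ : μ (dynClosedBall act (Fs n) y ε) ≤ w n), dynBall act (Fs n) y (ε / 2)
  have hU : ∀ j, IsOpen (U j) := fun j =>
    isOpen_iUnion fun n => isOpen_iUnion fun _ => isOpen_iUnion fun y => isOpen_iUnion fun _ =>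
      isOpen_dynBall hact_cont _ _ _
  have hae : ∀ᵐ x ∂μ, x ∈ ⋂ j, U j := by
    refine (ae_map_iff hfm.aemeasurable
      (MeasurableSet.iInter fun j => (hU j).measurableSet)).2 ?_
    filter_upwards [hpath, hbc] with ω hω hωbad
    have href := fun k => (hP k (ω k) (ω (k + 1)) (hω k).2).1
    refine Set.mem_iInter.2 fun j => ?_
    obtain ⟨k, hk, hjk⟩ := (hωbad.and (eventually_ge_atTop j)).exists
    simp only [U, Set.mem_iUnion]
    refine ⟨(ω (k + 1)).ord, hjk.trans (href k).le_ord, φ (ω (k + 1)).pt, not_lt.1 hk,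
      (href k).mem_dynBall _ ?_⟩
    exact pathLimit_mem_cylinder (fun k => (href k).mem_cylinder) (fun k => (href k).len_le)
      (fun k => (href k).lt_len) (k + 1)
  filter_upwards [hae] with x hx
  refine frequently_atTop.2 fun j => ?_
  have hxj := Set.mem_iInter.1 hx j
  simp only [U, Set.mem_iUnion] at hxj
  obtain ⟨n, hjn, y, hy, hxy⟩ := hxj
  exact ⟨n, hjn, (measure_mono (dynBall_subset_dynClosedBall_of_mem hxy)).trans hy⟩

end AmenablePacking
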